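/- Let q > 1 and let C ⊆ (Z_q)^n be a nonempty finite code of strength 1. Then the covering radius of C for the scaled homogeneous distance satisfies r(C) ≤ n·φ(q); equivalently, for every 𝐯 ∈ (Z_q)^n there exists a codeword 𝐜 ∈ C with d(𝐯,𝐜) ≤ n·φ(q). -/

import Mathlib

/-- `ζ_q^x = exp(2πi·x/q)` for `x ∈ ℤ/q`. -/
noncomputable def zetaPow (q : ℕ) (x : ZMod q) : ℂ :=
  Complex.exp (2 * Real.pi * Complex.I * x.val / q)

/-- The scaled homogeneous weight on `ℤ/q` (normalization `λ = φ(q)`), a real number: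
`wt(x) = φ(q) − ∑_{a ∈ (ℤ/q)ˣ} ζ_q^{a·x}` (the sum is real, so we take its real part). -/
noncomputable def wtHom (q : ℕ) [NeZero q] (x : ZMod q) : ℝ :=
  (Nat.totient q : ℝ) - (∑ a : (ZMod q)ˣ, zetaPow q ((a : ZMod q) * x)).re

/-- The scaled homogeneous distance between two vectors in `(ℤ/q)^n`. -/
noncomputable def homDist (q n : ℕ) [NeZero q] (u v : Fin n → ZMod q) : ℝ :=
  ∑ i, wtHom q (u i - v i)

/-- The covering radius of a code `C ⊆ (ℤ/q)^n` for the scaled homogeneous distance. -/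
noncomputable def covRad (q n : ℕ) [NeZero q] (C : Set (Fin n → ZMod q)) : ℝ :=
  ⨆ x : Fin n → ZMod q, ⨅ c : C, homDist q n x c

/-- `zetaPow` is Mathlib's standard additive character of `ℤ/q`. -/
theorem zetaPow_eq_stdAddChar (q : ℕ) [NeZero q] (x : ZMod q) :
    zetaPow q x = ZMod.stdAddChar x := by
  rw [zetaPow, ZMod.stdAddChar_apply, ZMod.toCircle_apply]

/-- The scaled homogeneous weight has average `φ(q)` over `ℤ/q`. -/
theorem sum_wtHom (q : ℕ) (hq : 1 < q) [NeZero q] :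
    ∑ x : ZMod q, wtHom q x = q * (Nat.totient q : ℝ) := by
  have hfact : Fact (1 < q) := ⟨hq⟩
  have hunit (a : (ZMod q)ˣ) : ∑ x : ZMod q, zetaPow q ((a : ZMod q) * x) = 0 := by
    have h := AddChar.sum_mulShift (a : ZMod q) (ZMod.isPrimitive_stdAddChar q)
    rw [if_neg a.ne_zero, Nat.cast_zero] at h
    simpa only [zetaPow_eq_stdAddChar, mul_comm] using h
  simp only [wtHom, Finset.sum_sub_distrib, ← Complex.re_sum]
  rw [Finset.sum_comm, Finset.sum_eq_zero fun a _ => hunit a]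
  simp [ZMod.card]

/-- Over a code of strength 1, averaging a function of one coordinate is averaging over `ℤ/q`. -/
theorem mul_sum_coord_of_strength_one (q n : ℕ) [NeZero q] (C : Finset (Fin n → ZMod q))
    (i : Fin n) (hstr : ∀ α : ZMod q, q * (C.filter (fun c => c i = α)).card = C.card)
    (f : ZMod q → ℝ) :
    (q : ℝ) * ∑ c ∈ C, f (c i) = C.card * ∑ α, f α := by
  rw [← Finset.sum_fiberwise C (fun c => c i), Finset.mul_sum, Finset.mul_sum]
  refine Finset.sum_congr rfl fun α _ => ?_
  rw [Finset.sum_congr rfl fun c hc => congrArg f (Finset.mem_filter.mp hc).2,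
    Finset.sum_const, nsmul_eq_mul, ← mul_assoc]
  congr 1
  exact_mod_cast hstr α

/-- The distances from a vector to a code of strength 1 have average `n·φ(q)`. -/
theorem sum_homDist_of_strength_one (q n : ℕ) (hq : 1 < q) [NeZero q]
    (C : Finset (Fin n → ZMod q))
    (hstr : ∀ i : Fin n, ∀ α : ZMod q, q * (C.filter (fun c => c i = α)).card = C.card)
    (v : Fin n → ZMod q) :
    ∑ c ∈ C, homDist q n v c = C.card * ((n : ℝ) * (Nat.totient q : ℝ)) := by
  have hq0 : (q : ℝ) ≠ 0 := NeZero.ne _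
  have hcoord (i : Fin n) :
      ∑ c ∈ C, wtHom q (v i - c i) = C.card * (Nat.totient q : ℝ) := by
    have htrans : ∑ α, wtHom q (v i - α) = ∑ α, wtHom q α :=
      (Equiv.subLeft (v i)).sum_comp (wtHom q)
    apply mul_left_cancel₀ hq0
    rw [mul_sum_coord_of_strength_one q n C i (hstr i) (fun α => wtHom q (v i - α)),
      htrans, sum_wtHom q hq]
    ring
  simp only [homDist]
  rw [Finset.sum_comm, Finset.sum_congr rfl fun i _ => hcoord i]
  simp only [Finset.sum_const, Finset.card_univ, Fintype.card_fin, nsmul_eq_mul]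
  ring

/-- if `q > 1` and `C ⊆ (ℤ/q)^n` is a nonempty (finite) code of strength 1,
then for every `𝐯 ∈ (ℤ/q)^n` some codeword is within scaled homogeneous distance
`n·φ(q)` of `𝐯`; equivalently `r(C) ≤ n·φ(q)`. -/
theorem covRad_le_of_strength_one (q n : ℕ) (hq : 1 < q) [NeZero q]
    (C : Finset (Fin n → ZMod q)) (hC : C.Nonempty)
    (hstr : ∀ i : Fin n, ∀ α : ZMod q,
      q * (C.filter (fun c => c i = α)).card = C.card) :
    (∀ v : Fin n → ZMod q, ∃ c ∈ C, homDist q n v c ≤ (n : ℝ) * (Nat.totient q : ℝ)) ∧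
    covRad q n (↑C : Set (Fin n → ZMod q)) ≤ (n : ℝ) * (Nat.totient q : ℝ) := by
  have hclose (v : Fin n → ZMod q) :
      ∃ c ∈ C, homDist q n v c ≤ (n : ℝ) * (Nat.totient q : ℝ) := by
    apply Finset.exists_le_of_sum_le hC
    rw [sum_homDist_of_strength_one q n hq C hstr v, Finset.sum_const, nsmul_eq_mul]
  refine ⟨hclose, ciSup_le fun v => ?_⟩
  obtain ⟨c, hc, hle⟩ := hclose v
  exact (ciInf_le (Set.finite_range _).bddBelow (⟨c, hc⟩ : (↑C : Set (Fin n → ZMod q)))).trans hle
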